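/- Let n, β be real numbers with n ≥ 2 and β ≥ 1, and let j be a natural number with j ≥ 1 satisfying j·(n − 1) ≤ β·n − 1. Then the sum ∑_{i=0}^{j} (n − i) = (j + 1)·n − j·(j + 1)/2 is at most (β + 1)·n. -/

import Mathlib

open Finset in
/-- For real `n ≥ 2`, `β ≥ 1` and a natural number `j ≥ 1` with
`j·(n−1) ≤ β·n − 1`, the sum `∑_{i=0}^{j} (n − i) = (j+1)·n − j·(j+1)/2` is at most
`(β + 1)·n`. -/
theorem stmt_2 (n β : ℝ) (j : ℕ) (hn : 2 ≤ n) (hβ : 1 ≤ β) (hj : 1 ≤ j)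
    (h : (j : ℝ) * (n - 1) ≤ β * n - 1) :
    (∑ i ∈ Finset.range (j + 1), (n - (i : ℝ)))
      = ((j : ℝ) + 1) * n - (j : ℝ) * ((j : ℝ) + 1) / 2 ∧
    (∑ i ∈ Finset.range (j + 1), (n - (i : ℝ))) ≤ (β + 1) * n := by
  have key : ∀ k : ℕ, (∑ i ∈ Finset.range (k + 1), (n - (i : ℝ)))
      = ((k : ℝ) + 1) * n - (k : ℝ) * ((k : ℝ) + 1) / 2 := by
    intro k
    induction k with
    | zero => simp
    | succ k ih =>
      rw [Finset.sum_range_succ, ih]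
      push_cast
      ring
  refine ⟨key j, ?_⟩
  rw [key j]
  nlinarith [sq_nonneg ((j : ℝ) - 1 / 2)]
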